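/- Let H be a connected simple graph with s := |V(H)| vertices and minimum degree d := δ(H) ≥ 3. Then there is a constant C (depending only on H) such that for every sufficiently large n there exists an M(H)-saturated simple graph on n vertices with at most ((d-1) + (C(s-1,2) + C(d,2) - (d-1)(s-1)) / (C(s-1,d-1) + (s-1) - d)) · n + C edges, where C(a,b) denotes the binomial coefficient. -/

import Mathlib

/-- `H.IsMinorOf G` : `H` is a minor of `G`, via the branch-set (model) definition:
there are pairwise disjoint nonempty connected subsets of `V(G)`, one for each vertex
of `H`, with an edge of `G` between the branch sets corresponding to each edge of `H`. -/
def SimpleGraph.IsMinorOf {W V : Type*} (H : SimpleGraph W) (G : SimpleGraph V) : Prop :=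
  ∃ B : W → Set V,
    (∀ w, (B w).Nonempty) ∧
    (∀ w, (G.induce (B w)).Connected) ∧
    (Pairwise fun w₁ w₂ => Disjoint (B w₁) (B w₂)) ∧
    ∀ ⦃w₁ w₂⦄, H.Adj w₁ w₂ → ∃ v₁ ∈ B w₁, ∃ v₂ ∈ B w₂, G.Adj v₁ v₂

/-- The graph `G + uv` obtained from `G` by adding the edge `uv`. -/
def SimpleGraph.addEdge {V : Type*} (G : SimpleGraph V) (u v : V) : SimpleGraph V :=
  G ⊔ SimpleGraph.fromEdgeSet {s(u, v)}

/-- `G` is `M(H)`-saturated: `G` has no `H`-minor, but adding any edge between two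
distinct non-adjacent vertices creates an `H`-minor. -/
def MinorSaturated {W V : Type*} (H : SimpleGraph W) (G : SimpleGraph V) : Prop :=
  ¬ H.IsMinorOf G ∧
    ∀ u v : V, u ≠ v → ¬ G.Adj u v → H.IsMinorOf (G.addEdge u v)

namespace SimpleGraph

/-- `G.SetConnected X` : `X` is nonempty and has no proper nonempty part that is closed under
taking neighbours inside `X`. -/
def SetConnected {V : Type*} (G : SimpleGraph V) (X : Set V) : Prop :=
  X.Nonempty ∧ ∀ P : Set V, (∃ a ∈ X, a ∈ P) →
    (∀ a ∈ X, a ∈ P → ∀ b ∈ X, G.Adj a b → b ∈ P) → X ⊆ P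

theorem induce_connected_iff_setConnected {V : Type*} {G : SimpleGraph V} {X : Set V} :
    (G.induce X).Connected ↔ G.SetConnected X := by
  constructor
  · intro h
    obtain ⟨⟨x, hx⟩⟩ := h.nonempty
    refine ⟨⟨x, hx⟩, ?_⟩
    rintro P ⟨a, ha, haP⟩ hP b hb
    obtain ⟨p⟩ := h.preconnected ⟨a, ha⟩ ⟨b, hb⟩
    have key : ∀ u v : X, (G.induce X).Walk u v → u.1 ∈ P → v.1 ∈ P := by
      intro u v q
      induction q with
      | nil => exact id
      | cons hadj _ ih => exact fun hu => ih (hP _ (Subtype.prop _) hu _ (Subtype.prop _) hadj)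
    exact key _ _ p haP
  · rintro ⟨⟨x, hx⟩, h⟩
    have : Nonempty X := ⟨⟨x, hx⟩⟩
    refine ⟨?_⟩
    rintro ⟨a, ha⟩ ⟨b, hb⟩
    obtain ⟨_, h2⟩ := h {c | ∃ hc : c ∈ X, (G.induce X).Reachable ⟨a, ha⟩ ⟨c, hc⟩}
      ⟨a, ha, ha, Reachable.refl _⟩
      (fun u _ ⟨hu, hr⟩ v hv huv =>
        ⟨hv, hr.trans (Adj.reachable (show (G.induce X).Adj ⟨u, hu⟩ ⟨v, hv⟩ from huv))⟩) hb
    exact h2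

theorem setConnected_singleton {V : Type*} (G : SimpleGraph V) (a : V) :
    G.SetConnected {a} := by
  refine ⟨⟨a, rfl⟩, ?_⟩
  rintro P ⟨b, rfl, hb⟩ _ c rfl
  exact hb

theorem setConnected_pair {V : Type*} {G : SimpleGraph V} {a b : V} (h : a = b ∨ G.Adj a b) :
    G.SetConnected {a, b} := by
  rcases h with rfl | h
  · simpa using setConnected_singleton G a
  · refine ⟨⟨a, by simp⟩, ?_⟩
    rintro P ⟨c, rfl | rfl, hc⟩ hP
    · have := hP _ (by simp) hc b (by simp) h
      rintro e (rfl | rfl) <;> assumption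
    · have := hP _ (by simp) hc a (by simp) h.symm
      rintro e (rfl | rfl) <;> assumption

theorem SetConnected.union {V : Type*} {G : SimpleGraph V} {X Y : Set V} {x y : V}
    (hX : G.SetConnected X) (hY : G.SetConnected Y) (hx : x ∈ X) (hy : y ∈ Y)
    (hxy : G.Adj x y) : G.SetConnected (X ∪ Y) := by
  refine ⟨⟨x, Or.inl hx⟩, ?_⟩
  rintro P ⟨c, hc, hcP⟩ hP
  have hXP : (∃ a ∈ X, a ∈ P) → X ⊆ P := fun h =>
    hX.2 P h fun a ha haP b hb => hP a (Or.inl ha) haP b (Or.inl hb)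
  have hYP : (∃ a ∈ Y, a ∈ P) → Y ⊆ P := fun h =>
    hY.2 P h fun a ha haP b hb => hP a (Or.inr ha) haP b (Or.inr hb)
  rcases hc with hc | hc
  · have h1 := hXP ⟨c, hc, hcP⟩
    exact Set.union_subset h1 (hYP ⟨y, hy, hP x (Or.inl hx) (h1 hx) y (Or.inr hy) hxy⟩)
  · have h1 := hYP ⟨c, hc, hcP⟩
    exact Set.union_subset
      (hXP ⟨x, hx, hP y (Or.inr hy) (h1 hy) x (Or.inl hx) hxy.symm⟩) h1

/-- A vertex of a connected set with at least two elements has a neighbour in that set. -/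
theorem SetConnected.exists_adj {V : Type*} {G : SimpleGraph V} {X : Set V} {a b : V}
    (hX : G.SetConnected X) (ha : a ∈ X) (hb : b ∈ X) (hab : a ≠ b) :
    ∃ c ∈ X, G.Adj a c := by
  by_contra! h
  have := hX.2 {a} ⟨a, ha, rfl⟩ (by rintro _ _ rfl c hc hac; exact absurd hac (h c hc)) hb
  exact hab this.symm

theorem isMinorOf_iff_setConnected {W V : Type*} {H : SimpleGraph W} {G : SimpleGraph V} :
    H.IsMinorOf G ↔ ∃ B : W → Set V,
      (∀ w, G.SetConnected (B w)) ∧ (Pairwise fun w₁ w₂ => Disjoint (B w₁) (B w₂)) ∧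
      ∀ ⦃w₁ w₂⦄, H.Adj w₁ w₂ → ∃ v₁ ∈ B w₁, ∃ v₂ ∈ B w₂, G.Adj v₁ v₂ := by
  simp only [IsMinorOf, induce_connected_iff_setConnected]
  exact ⟨fun ⟨B, _, h⟩ => ⟨B, h⟩, fun ⟨B, h⟩ => ⟨B, fun w => (h.1 w).1, h⟩⟩

theorem IsMinorOf.map {W V V' : Type*} {H : SimpleGraph W} {G : SimpleGraph V}
    {G' : SimpleGraph V'} (h : H.IsMinorOf G) (f : V → V') (hf : Function.Injective f)
    (hadj : ∀ a b, G.Adj a b → G'.Adj (f a) (f b)) : H.IsMinorOf G' := by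
  rw [isMinorOf_iff_setConnected] at h ⊢
  obtain ⟨B, h1, h2, h3⟩ := h
  refine ⟨fun w => f '' B w, fun w => ⟨(h1 w).1.image f, ?_⟩, fun w₁ w₂ hw =>
    (Set.disjoint_image_iff hf).2 (h2 hw), fun w₁ w₂ hw => ?_⟩
  · rintro P ⟨_, ⟨a, ha, rfl⟩, haP⟩ hP
    rw [Set.image_subset_iff]
    exact (h1 w).2 _ ⟨a, ha, haP⟩ fun u hu huP v hv huv =>
      hP _ ⟨u, hu, rfl⟩ huP _ ⟨v, hv, rfl⟩ (hadj _ _ huv)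
  · obtain ⟨a, ha, b, hb, hab⟩ := h3 hw
    exact ⟨f a, ⟨a, ha, rfl⟩, f b, ⟨b, hb, rfl⟩, hadj _ _ hab⟩

theorem addEdge_adj {V : Type*} {G : SimpleGraph V} {u v a b : V} :
    (G.addEdge u v).Adj a b ↔ G.Adj a b ∨ (s(a, b) = s(u, v) ∧ a ≠ b) := by
  simp [addEdge]

theorem addEdge_comm {V : Type*} (G : SimpleGraph V) (u v : V) :
    G.addEdge u v = G.addEdge v u := by
  rw [addEdge, addEdge, Sym2.eq_swap]

theorem _root_.MinorSaturated.of_iso {W V V' : Type*} {H : SimpleGraph W} {G : SimpleGraph V}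
    {G' : SimpleGraph V'} (h : MinorSaturated H G) (e : G ≃g G') : MinorSaturated H G' := by
  refine ⟨fun h' => h.1 (h'.map e.symm e.symm.injective fun a b => e.symm.map_adj_iff.2),
    fun u v huv hadj => ?_⟩
  refine (h.2 (e.symm u) (e.symm v) (e.symm.injective.ne huv)
    (by rwa [e.symm.map_adj_iff])).map e e.injective ?_
  intro a b hab
  rw [addEdge_adj] at hab ⊢
  rcases hab with hab | ⟨hab, hne⟩
  · exact Or.inl (e.map_adj_iff.2 hab)
  · refine Or.inr ⟨?_, e.injective.ne hne⟩
    have := congrArg (Sym2.map e) hab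
    simpa using this

/-- A finite type covered by finsets embeds compatibly into a family of disjoint finsets that are
at least as large. -/
theorem exists_injective_mem {W V ι : Type*} (A : ι → Finset W) (B : ι → Finset V)
    (hA : ∀ w, ∃ i, w ∈ A i) (hB : ∀ i j, i ≠ j → Disjoint (B i) (B j))
    (hcard : ∀ i, (A i).card ≤ (B i).card) :
    ∃ f : W → V, Function.Injective f ∧ ∀ w, ∃ i, w ∈ A i ∧ f w ∈ B i := by
  have g : ∀ i, A i ↪ B i := fun i =>
    Classical.choice (Function.Embedding.nonempty_of_card_le (by simpa using hcard i))
  choose l hl using hA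
  have key : ∀ i i' w w' (hi : w ∈ A i) (hi' : w' ∈ A i'), i = i' →
      (g i ⟨w, hi⟩ : V) = g i' ⟨w', hi'⟩ → w = w' := by
    rintro i _ w w' hi hi' rfl h
    exact congrArg Subtype.val ((g i).injective (Subtype.ext h))
  refine ⟨fun w => g (l w) ⟨w, hl w⟩, fun w w' h => ?_, fun w => ⟨l w, hl w, (g _ _).2⟩⟩
  refine key _ _ _ _ (hl w) (hl w') ?_ h
  by_contra hne
  dsimp only at h
  exact Finset.disjoint_left.1 (hB _ _ hne) (g (l w) ⟨w, hl w⟩).2 (h ▸ (g (l w') ⟨w', hl w'⟩).2)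

/-- A clique, one of whose vertices `c` is blown up to `X`, together with a further connected set
`Y` that sees enough of the clique, has an `H`-minor. -/
theorem isMinorOf_of_clique {W V : Type*} [Fintype W] {H : SimpleGraph W}
    {G : SimpleGraph V} {Q D : Finset V} {c : V} {X Y : Set V} {w₀ : W}
    [Fintype (H.neighborSet w₀)]
    (hQ : G.IsClique Q) (hcard : Fintype.card W = Q.card + 1) (hc : c ∈ Q) (hD : D ⊆ Q)
    (hcD : c ∉ D) (hdeg : H.degree w₀ = D.card + 1)
    (hX : G.SetConnected X) (hY : G.SetConnected Y) (hcX : c ∈ X)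
    (hXQ : ∀ a ∈ X, a ∈ Q → a = c) (hYQ : ∀ a ∈ Y, a ∉ Q) (hXY : Disjoint X Y)
    (hYD : ∀ a ∈ D, ∃ y ∈ Y, G.Adj y a) (hadj : ∃ y ∈ Y, ∃ x ∈ X, G.Adj y x) :
    H.IsMinorOf G := by
  classical
  obtain ⟨y₀, hy₀⟩ := hY.1
  have hDQ : insert c D ⊆ Q := Finset.insert_subset hc hD
  have hDc : (insert c D).card = D.card + 1 := Finset.card_insert_of_notMem hcD
  have hN : (Finset.univ.filter fun w => H.Adj w₀ w).card = D.card + 1 := by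
    rw [← hdeg, ← card_neighborFinset_eq_degree]
    congr 1
    ext w
    simp
  have h1 : y₀ ∉ Q := hYQ _ hy₀
  have h2 : y₀ ∉ insert c D := fun h => h1 (hDQ h)
  set N := Finset.univ.filter fun w => H.Adj w₀ w with hNdef
  have hw₀N : w₀ ∉ N := by simp [hNdef]
  have hR : ((insert w₀ N)ᶜ).card + (D.card + 1) = Q.card := by
    have := Finset.card_compl_add_card (insert w₀ N)
    rw [Finset.card_insert_of_notMem hw₀N] at this
    omega
  obtain ⟨f, hf, hfB⟩ := exists_injective_mem ![{w₀}, N, (insert w₀ N)ᶜ]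
    ![{y₀}, insert c D, Q \ insert c D] (by
      intro w
      by_cases hw : w = w₀
      · exact ⟨0, by simp [hw]⟩
      · by_cases hwN : w ∈ N
        · exact ⟨1, by simpa using hwN⟩
        · exact ⟨2, by simp [hw, hwN]⟩) (by
      have h3 : Disjoint {y₀} (insert c D) := Finset.disjoint_singleton_left.2 h2
      have h4 : Disjoint {y₀} (Q \ insert c D) :=
        Finset.disjoint_singleton_left.2 fun h => h1 (Finset.mem_sdiff.1 h).1
      have h5 : Disjoint (insert c D) (Q \ insert c D) := Finset.disjoint_sdiff
      intro i j hij
      fin_cases i <;> fin_cases j <;>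
        first
        | exact absurd rfl hij
        | assumption
        | (apply Disjoint.symm; assumption)) (by
      intro i
      fin_cases i
      · simp
      · exact (hN.trans hDc.symm).le
      · change ((insert w₀ N)ᶜ).card ≤ (Q \ insert c D).card
        rw [Finset.card_sdiff_of_subset hDQ]
        omega)
  have hf₀ : f w₀ = y₀ := by
    obtain ⟨i, hi, hfi⟩ := hfB w₀
    fin_cases i
    · simpa using hfi
    · exact absurd hi hw₀N
    · simp at hi
  have hfN : ∀ w, H.Adj w₀ w → f w = c ∨ f w ∈ D := by
    intro w hw
    obtain ⟨i, hi, hfi⟩ := hfB w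
    fin_cases i
    · simp at hi
      exact absurd (hi ▸ hw) (H.loopless.irrefl _)
    · simpa using hfi
    · simp [hNdef, hw] at hi
  have hfQ : ∀ w, w ≠ w₀ → f w ∈ Q := by
    intro w hw
    obtain ⟨i, hi, hfi⟩ := hfB w
    fin_cases i
    · simp at hi
      exact absurd hi hw
    · exact hDQ hfi
    · exact (Finset.mem_sdiff.1 hfi).1
  let B : W → Set V := fun w => if w = w₀ then Y else if f w = c then X else {f w}
  have hfmem : ∀ w, f w ∈ B w := by
    intro w
    by_cases hw : w = w₀
    · simpa [B, hw, hf₀] using hy₀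
    · by_cases hwc : f w = c
      · simpa [B, hw, hwc] using hcX
      · simp [B, hw, hwc]
  have hBc : ∀ w, w ≠ w₀ → f w = c → B w = X := fun w h h' => by simp [B, h, h']
  have hBQ : ∀ w, w ≠ w₀ → f w ≠ c → B w = {f w} := fun w h h' => by simp [B, h, h']
  have hB₀ : B w₀ = Y := by simp [B]
  rw [isMinorOf_iff_setConnected]
  refine ⟨B, fun w => ?_, ?_, ?_⟩
  · simp only [B]
    split_ifs
    exacts [hY, hX, setConnected_singleton _ _]
  · have hdis₀ : ∀ w, w ≠ w₀ → Disjoint Y (B w) := by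
      intro w hw
      by_cases hwc : f w = c
      · rw [hBc w hw hwc]
        exact hXY.symm
      · rw [hBQ w hw hwc]
        exact Set.disjoint_singleton_right.2 fun h => hYQ _ h (hfQ w hw)
    have hdisc : ∀ w w', w ≠ w₀ → f w ≠ c → w' ≠ w → Disjoint (B w') (B w) := by
      intro w w' hw hwc hne
      by_cases hw' : w' = w₀
      · rw [hw', hB₀]
        exact hdis₀ w hw
      · rw [hBQ w hw hwc]
        refine Set.disjoint_singleton_right.2 fun h => ?_
        by_cases hwc' : f w' = c
        · rw [hBc w' hw' hwc'] at h
          exact hwc (hXQ _ h (hfQ w hw))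
        · rw [hBQ w' hw' hwc'] at h
          exact hne (hf h).symm
    intro w w' hne
    by_cases hw : w = w₀
    · subst hw
      rw [hB₀]
      exact hdis₀ w' hne.symm
    · by_cases hw' : w' = w₀
      · subst hw'
        rw [hB₀]
        exact (hdis₀ w hne).symm
      · by_cases hwc : f w = c
        · exact hdisc w' w hw' (fun h => hne (hf (hwc.trans h.symm))) hne
        · exact (hdisc w w' hw hwc hne.symm).symm
  · have hadj₀ : ∀ w, H.Adj w₀ w → ∃ v₁ ∈ Y, ∃ v₂ ∈ B w, G.Adj v₁ v₂ := by
      intro w hw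
      rcases hfN w hw with h | h
      · rw [hBc w hw.ne' h]
        exact hadj
      · obtain ⟨y, hy, hya⟩ := hYD _ h
        exact ⟨y, hy, f w, hfmem w, hya⟩
    intro w w' hww'
    by_cases hw : w = w₀
    · subst hw
      rw [hB₀]
      exact hadj₀ w' hww'
    · by_cases hw' : w' = w₀
      · subst hw'
        rw [hB₀]
        obtain ⟨a, ha, b, hb, hab⟩ := hadj₀ w hww'.symm
        exact ⟨b, hb, a, ha, hab.symm⟩
      · exact ⟨f w, hfmem w, f w', hfmem w',
          hQ (hfQ w hw) (hfQ w' hw') (hf.ne hww'.ne)⟩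

/-- `K` separates the remaining vertices of `H` into the nonempty parts `A` and `B`. -/
structure Separates {W : Type*} (H : SimpleGraph W) (K A B : Finset W) : Prop where
  left_nonempty : A.Nonempty
  right_nonempty : B.Nonempty
  disjoint_left : Disjoint K A
  disjoint_right : Disjoint K B
  disjoint : Disjoint A B
  cover : ∀ w, w ∈ K ∨ w ∈ A ∨ w ∈ B
  not_adj : ∀ a ∈ A, ∀ b ∈ B, ¬ H.Adj a b

/-- Two cliques glued along `S`, together with a connected set `L` that sees all of them, have an
`H`-minor as soon as `H` has a separator of size at most `S.card + 1` with small enough sides. -/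
theorem isMinorOf_of_separates {W V : Type*} {H : SimpleGraph W} {G : SimpleGraph V}
    {K A B : Finset W} (h : H.Separates K A B) (hK : K.Nonempty) {S P Q : Finset V} {L : Set V}
    (hKS : K.card ≤ S.card + 1) (hAP : A.card ≤ P.card) (hBQ : B.card ≤ Q.card)
    (hSP : Disjoint S P) (hSQ : Disjoint S Q) (hPQ : Disjoint P Q)
    (hSPc : ∀ a b, a ∈ S ∨ a ∈ P → b ∈ S ∨ b ∈ P → a ≠ b → G.Adj a b)
    (hSQc : ∀ a b, a ∈ S ∨ a ∈ Q → b ∈ S ∨ b ∈ Q → a ≠ b → G.Adj a b)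
    (hL : G.SetConnected L) (hLd : ∀ a ∈ L, a ∉ S ∧ a ∉ P ∧ a ∉ Q)
    (hLa : ∀ a, a ∈ S ∨ a ∈ P ∨ a ∈ Q → ∃ l ∈ L, G.Adj l a) :
    H.IsMinorOf G := by
  classical
  obtain ⟨l₀, hl₀⟩ := hL.1
  obtain ⟨w₀, hw₀⟩ := hK
  obtain ⟨h1, h2, h3⟩ := hLd _ hl₀
  obtain ⟨f, hf, hfB⟩ := exists_injective_mem ![{w₀}, K.erase w₀, A, B] ![{l₀}, S, P, Q] (by
      intro w
      by_cases hw : w = w₀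
      · exact ⟨0, by simp [hw]⟩
      · rcases h.cover w with hw' | hw' | hw'
        · exact ⟨1, by simp [hw, hw']⟩
        · exact ⟨2, hw'⟩
        · exact ⟨3, hw'⟩) (by
      have h4 := Finset.disjoint_singleton_left.2 h1
      have h5 := Finset.disjoint_singleton_left.2 h2
      have h6 := Finset.disjoint_singleton_left.2 h3
      intro i j hij
      fin_cases i <;> fin_cases j <;>
        first
        | exact absurd rfl hij
        | assumption
        | (apply Disjoint.symm; assumption)) (by
      intro i
      fin_cases i
      · simp
      · change (K.erase w₀).card ≤ S.card
        rw [Finset.card_erase_of_mem hw₀]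
        omega
      · exact hAP
      · exact hBQ)
  have hf' : ∀ w, w ≠ w₀ → (w ∈ K ∧ f w ∈ S) ∨ (w ∈ A ∧ f w ∈ P) ∨ (w ∈ B ∧ f w ∈ Q) := by
    intro w hw
    obtain ⟨i, hi, hfi⟩ := hfB w
    fin_cases i
    · exact absurd (Finset.mem_singleton.1 hi) hw
    · exact Or.inl ⟨Finset.mem_of_mem_erase hi, hfi⟩
    · exact Or.inr (Or.inl ⟨hi, hfi⟩)
    · exact Or.inr (Or.inr ⟨hi, hfi⟩)
  have hfmem : ∀ w, w ≠ w₀ → f w ∈ S ∨ f w ∈ P ∨ f w ∈ Q := by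
    intro w hw
    rcases hf' w hw with h | h | h
    · exact Or.inl h.2
    · exact Or.inr (Or.inl h.2)
    · exact Or.inr (Or.inr h.2)
  have hLf : ∀ w, w ≠ w₀ → f w ∉ L := by
    intro w hw hwL
    have := hLd _ hwL
    have := hfmem w hw
    tauto
  rw [isMinorOf_iff_setConnected]
  refine ⟨fun w => if w = w₀ then L else {f w}, fun w => ?_, ?_, ?_⟩
  · dsimp only
    split_ifs
    exacts [hL, setConnected_singleton _ _]
  · intro w w' hne
    by_cases hw : w = w₀
    · have hw' : w' ≠ w₀ := fun h => hne (hw.trans h.symm)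
      simpa [hw, hw'] using hLf w' hw'
    · by_cases hw' : w' = w₀
      · simpa [hw, hw'] using hLf w hw
      · simpa [hw, hw'] using hf.ne hne
  · intro w w' hww'
    by_cases hw : w = w₀
    · have hw' : w' ≠ w₀ := fun h => hww'.ne (hw.trans h.symm)
      simpa [hw, hw'] using hLa _ (hfmem w' hw')
    · by_cases hw' : w' = w₀
      · obtain ⟨l, hl, hla⟩ := hLa _ (hfmem w hw)
        simpa [hw, hw'] using ⟨l, hl, hla.symm⟩
      · have hff := hf.ne hww'.ne
        have hn1 : w ∈ A → w' ∈ B → False := fun ha hb => h.not_adj _ ha _ hb hww'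
        have hn2 : w ∈ B → w' ∈ A → False := fun hb ha => h.not_adj _ ha _ hb hww'.symm
        have : G.Adj (f w) (f w') := by
          have hc1 := hSPc (f w) (f w')
          have hc2 := hSQc (f w) (f w')
          rcases hf' w hw with hd | hd | hd <;> rcases hf' w' hw' with hd' | hd' | hd' <;>
            first
            | exact hc1 (Or.inl hd.2) (Or.inl hd'.2) hff
            | exact hc1 (Or.inl hd.2) (Or.inr hd'.2) hff
            | exact hc1 (Or.inr hd.2) (Or.inl hd'.2) hff
            | exact hc1 (Or.inr hd.2) (Or.inr hd'.2) hff
            | exact hc2 (Or.inl hd.2) (Or.inr hd'.2) hff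
            | exact hc2 (Or.inr hd.2) (Or.inl hd'.2) hff
            | exact hc2 (Or.inr hd.2) (Or.inr hd'.2) hff
            | exact (hn1 hd.1 hd'.1).elim
            | exact (hn2 hd.1 hd'.1).elim
        simpa [hw, hw'] using this

/-- The critical gluing size: `H` has no separator of size at most `k`, but it has one of size
`k + 1` unless `k = b`. -/
theorem exists_critical_separator_size {W : Type*} {H : SimpleGraph W}
    (hconn : H.Connected) (b : ℕ) :
    ∃ k ≤ b, (∀ K A B, H.Separates K A B → k < K.card) ∧
      (k = b ∨ ∃ K A B, H.Separates K A B ∧ K.card = k + 1) := by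
  classical
  by_cases h : ∃ j, j ≤ b ∧ ∃ K A B, H.Separates K A B ∧ K.card = j
  · obtain ⟨hjb, K, A, B, hS, hK⟩ := Nat.find_spec h
    have hmin : ∀ K A B, H.Separates K A B → Nat.find h ≤ K.card := by
      intro K A B hS
      by_cases hKb : K.card ≤ b
      · exact Nat.find_min' h ⟨hKb, K, A, B, hS, rfl⟩
      · omega
    have hpos : 0 < Nat.find h := by
      rw [← hK, Finset.card_pos]
      by_contra hne
      rw [Finset.not_nonempty_iff_eq_empty] at hne
      obtain ⟨a, ha⟩ := hS.left_nonempty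
      obtain ⟨c, hc⟩ := hS.right_nonempty
      obtain ⟨p⟩ := hconn.preconnected a c
      have key : ∀ u v : W, H.Walk u v → u ∈ A → v ∈ A := by
        intro u v q
        induction q with
        | nil => exact id
        | @cons u v w hadj _ ih =>
          intro hu
          refine ih ?_
          have h1 := hS.cover v
          have h2 := hS.not_adj u hu v
          simp only [hne, Finset.notMem_empty, false_or] at h1
          tauto
      exact Finset.disjoint_left.1 hS.disjoint (key _ _ p ha) hc
    refine ⟨Nat.find h - 1, by omega, fun K A B hS => ?_, Or.inr ⟨K, A, B, hS, by omega⟩⟩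
    have := hmin K A B hS
    omega
  · refine ⟨b, le_rfl, fun K A B hS => ?_, Or.inl rfl⟩
    by_contra hlt
    exact h ⟨K.card, by omega, K, A, B, hS, rfl⟩

/-- At most `Q.card` members of a disjoint family meet the finset `Q`. -/
theorem card_le_card_of_disjoint_of_meet {W V : Type*} {B : W → Set V}
    (hB : Pairwise fun w₁ w₂ => Disjoint (B w₁) (B w₂)) {R : Finset W} {Q : Finset V}
    (h : ∀ w ∈ R, ∃ a ∈ Q, a ∈ B w) : R.card ≤ Q.card := by
  rcases R.eq_empty_or_nonempty with rfl | ⟨r, hr⟩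
  · simp
  have : Nonempty V := (h r hr).nonempty
  choose! g hg hgB using h
  refine Finset.card_le_card_of_injOn g hg fun w₁ h₁ w₂ h₂ h12 => ?_
  by_contra hne
  exact Set.disjoint_left.1 (hB hne) (hgB _ h₁) (h12 ▸ hgB _ h₂)

/-- The graph obtained from `G` by attaching, for every `A ∈ T`, a new vertex with
neighbourhood `A`. -/
def attach {U : Type*} (G : SimpleGraph U) (T : Finset (Finset U)) : SimpleGraph (U ⊕ T) where
  Adj
    | .inl a, .inl b => G.Adj a b
    | .inl a, .inr A => a ∈ A.1
    | .inr A, .inl a => a ∈ A.1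
    | .inr _, .inr _ => False
  symm := ⟨by rintro (a | A) (b | B) h <;> first | exact h.symm | exact h⟩
  loopless := ⟨by rintro (a | A) h <;> first | exact G.loopless.irrefl _ h | exact h⟩

/-- Attaching vertices to cliques smaller than the minimum degree of `H` creates no `H`-minor. -/
theorem IsMinorOf.of_attach {W U : Type*} [Fintype W] {H : SimpleGraph W} [DecidableRel H.Adj]
    {G : SimpleGraph U} {T : Finset (Finset U)} (hT : ∀ A ∈ T, G.IsClique A)
    (hTc : ∀ A ∈ T, A.card < H.minDegree) (h : H.IsMinorOf (attach G T)) : H.IsMinorOf G := by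
  classical
  rw [isMinorOf_iff_setConnected] at h ⊢
  obtain ⟨B, hB, hdis, hadj⟩ := h
  have hne : ∀ w, ∃ a, Sum.inl a ∈ B w := by
    intro w
    by_contra! hno
    obtain ⟨v, hv⟩ := (hB w).1
    rcases v with a | A
    · exact hno a hv
    have hBw : ∀ v ∈ B w, v = Sum.inr A := by
      intro v hvw
      by_contra hne
      obtain ⟨c, hc, hca⟩ := (hB w).exists_adj hv hvw (Ne.symm hne)
      rcases c with c | C
      · exact hno c hc
      · exact hca
    have hN : ∀ w' ∈ H.neighborFinset w, ∃ a ∈ A.1, Sum.inl a ∈ B w' := by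
      intro w' hw'
      rw [mem_neighborFinset] at hw'
      obtain ⟨u, hu, u', hu', huu'⟩ := hadj hw'
      rw [hBw u hu] at huu'
      rcases u' with a | C
      · exact ⟨a, huu', hu'⟩
      · exact huu'.elim
    have hcard := card_le_card_of_disjoint_of_meet
      (B := fun w => Sum.inl ⁻¹' B w) (fun w₁ w₂ hw => (hdis hw).preimage _) hN
    have h1 := hTc A.1 A.2
    have h2 := H.minDegree_le_degree w
    rw [card_neighborFinset_eq_degree] at hcard
    omega
  have hin : ∀ w A, Sum.inr A ∈ B w → ∃ a ∈ A.1, Sum.inl a ∈ B w := by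
    intro w A hA
    obtain ⟨b, hb⟩ := hne w
    obtain ⟨c, hc, hAc⟩ := (hB w).exists_adj hA hb (by simp)
    rcases c with c | C
    · exact ⟨c, hAc, hc⟩
    · exact hAc.elim
  refine ⟨fun w => Sum.inl ⁻¹' B w, fun w => ⟨hne w, ?_⟩,
    fun w₁ w₂ hw => (hdis hw).preimage _, fun w₁ w₂ hw => ?_⟩
  · rintro P ⟨a, ha, haP⟩ hP
    have := (hB w).2 {v | Sum.elim (· ∈ P)
      (fun A => ∃ b ∈ A.1, Sum.inl b ∈ B w ∧ b ∈ P) v} ⟨_, ha, haP⟩ ?_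
    · exact fun b hb => this hb
    · rintro (u | A) hu huP (v | A') hv huv
      · exact hP u hu huP v hv huv
      · exact ⟨u, huv, hu, huP⟩
      · obtain ⟨b, hbA, hb, hbP⟩ := huP
        by_cases hbv : b = v
        · exact hbv ▸ hbP
        · exact hP b hb hbP v hv (hT A.1 A.2 hbA huv hbv)
      · exact huv.elim
  · have key : ∀ w₁ w₂ a A, w₁ ≠ w₂ → Sum.inl a ∈ B w₁ → Sum.inr A ∈ B w₂ → a ∈ A.1 →
        ∃ b, Sum.inl b ∈ B w₂ ∧ G.Adj a b := by
      intro w₁ w₂ a A hw ha hA haA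
      obtain ⟨b, hbA, hb⟩ := hin w₂ A hA
      refine ⟨b, hb, hT A.1 A.2 haA hbA ?_⟩
      rintro rfl
      exact Set.disjoint_left.1 (hdis hw) ha hb
    obtain ⟨u, hu, v, hv, huv⟩ := hadj hw
    rcases u with u | A <;> rcases v with v | A'
    · exact ⟨u, hu, v, hv, huv⟩
    · obtain ⟨b, hb, hab⟩ := key _ _ u A' hw.ne hu hv huv
      exact ⟨u, hu, b, hb, hab⟩
    · obtain ⟨b, hb, hab⟩ := key _ _ v A hw.ne' hv hu huv
      exact ⟨b, hb, v, hv, hab.symm⟩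
    · exact huv.elim

/-- The book with `m` pages: cliques on `k + x` vertices that share a spine of `k` vertices. -/
def cliqueBook (k m x : ℕ) : SimpleGraph (Fin k ⊕ Fin m × Fin x) where
  Adj a b := a ≠ b ∧ ∀ p q, a = .inr p → b = .inr q → p.1 = q.1
  symm := ⟨fun _ _ h => ⟨h.1.symm, fun p q hp hq => (h.2 q p hq hp).symm⟩⟩
  loopless := ⟨fun _ h => h.1 rfl⟩

/-- The spine of a book of cliques. -/
def bookSpine (k m x : ℕ) : Finset (Fin k ⊕ Fin m × Fin x) := Finset.univ.disjSum ∅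

/-- A page of a book of cliques, including the spine. -/
def bookPage (k : ℕ) {m : ℕ} (x : ℕ) (i : Fin m) : Finset (Fin k ⊕ Fin m × Fin x) :=
  Finset.univ.disjSum ({i} ×ˢ Finset.univ)

section book

variable {k m x : ℕ} {i j : Fin m}

@[simp] theorem inl_mem_bookSpine {a : Fin k} : Sum.inl a ∈ bookSpine k m x := by
  simp [bookSpine]

@[simp] theorem inr_notMem_bookSpine {p : Fin m × Fin x} : Sum.inr p ∉ bookSpine k m x := by
  simp [bookSpine]

@[simp] theorem inl_mem_bookPage {a : Fin k} : Sum.inl a ∈ bookPage k x i := by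
  simp [bookPage]

@[simp] theorem inr_mem_bookPage {p : Fin m × Fin x} :
    Sum.inr p ∈ bookPage k x i ↔ p.1 = i := by
  simp only [bookPage, Finset.inr_mem_disjSum, Finset.mem_product, Finset.mem_singleton,
    Finset.mem_univ, and_true]

@[simp] theorem card_bookSpine : (bookSpine k m x).card = k := by
  simp [bookSpine]

@[simp] theorem card_bookPage : (bookPage k x i).card = k + x := by
  simp [bookPage, Finset.card_disjSum]

theorem cliqueBook_isClique : (cliqueBook k m x).IsClique (bookPage k x i) := by
  rintro (a | p) ha (b | q) hb hab
  · exact ⟨hab, by simp⟩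
  · exact ⟨hab, by simp⟩
  · exact ⟨hab, by simp⟩
  · refine ⟨hab, ?_⟩
    rintro p' q' h h'
    simp only [Finset.mem_coe, inr_mem_bookPage] at ha hb
    simp only [Sum.inr.injEq] at h h'
    rw [← h, ← h', ha, hb]

/-- A book of cliques with fewer than `|H|` vertices per page has no `H`-minor if the spine is too
small to separate `H`. -/
theorem not_isMinorOf_cliqueBook {W : Type*} [Fintype W] {H : SimpleGraph W}
    (hsep : ∀ K A B, H.Separates K A B → k < K.card) (hcard : k + x < Fintype.card W) :
    ¬ H.IsMinorOf (cliqueBook k m x) := by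
  classical
  rw [isMinorOf_iff_setConnected]
  rintro ⟨B, hB, hdis, hadj⟩
  set K : Finset W := Finset.univ.filter fun w => ∃ a ∈ bookSpine k m x, a ∈ B w with hK
  have hKk : K.card ≤ k := by
    simpa using card_le_card_of_disjoint_of_meet hdis (R := K) (Q := bookSpine k m x)
      fun w hw => (Finset.mem_filter.1 hw).2
  have hout : ∀ w, w ∉ K → ∃ i : Fin m, ∀ a ∈ B w, ∃ p, a = Sum.inr (i, p) := by
    intro w hw
    have hns : ∀ a, Sum.inl a ∉ B w := by
      intro a ha
      exact hw (Finset.mem_filter.2 ⟨Finset.mem_univ _, _, inl_mem_bookSpine, ha⟩)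
    obtain ⟨v, hv⟩ := (hB w).1
    rcases v with a | ⟨i, p⟩
    · exact absurd hv (hns a)
    refine ⟨i, fun a ha => ?_⟩
    have := (hB w).2 {a | ∃ p, a = Sum.inr (i, p)} ⟨_, hv, p, rfl⟩ ?_
    · exact this ha
    · rintro _ _ ⟨p, rfl⟩ (b | ⟨j, q⟩) hb hab
      · exact absurd hb (hns b)
      · obtain rfl : i = j := hab.2 _ _ rfl rfl
        exact ⟨q, rfl⟩
  obtain ⟨w₀, hw₀⟩ : ∃ w, w ∉ K := by
    by_contra! hall
    have : Fintype.card W ≤ K.card := Finset.card_le_card fun w _ => hall w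
    omega
  obtain ⟨i, hi⟩ := hout w₀ hw₀
  have hall : ∀ w, w ∉ K → ∃ a ∈ bookPage k x i, a ∈ B w := by
    by_contra! hbad
    obtain ⟨w₁, hw₁K, hw₁⟩ := hbad
    refine (hsep K (Finset.univ.filter fun w => w ∉ K ∧ ∃ a ∈ bookPage k x i, a ∈ B w)
      (Finset.univ.filter fun w => w ∉ K ∧ ¬ ∃ a ∈ bookPage k x i, a ∈ B w)
      ⟨⟨w₀, ?_⟩, ⟨w₁, ?_⟩, ?_, ?_, ?_, ?_, ?_⟩).not_ge hKk
    · obtain ⟨v, hv⟩ := (hB w₀).1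
      obtain ⟨p, rfl⟩ := hi v hv
      exact Finset.mem_filter.2 ⟨Finset.mem_univ _, hw₀, _, by simp, hv⟩
    · exact Finset.mem_filter.2 ⟨Finset.mem_univ _, hw₁K, fun ⟨a, ha, haB⟩ => hw₁ a ha haB⟩
    · exact Finset.disjoint_left.2 fun w h h' => (Finset.mem_filter.1 h').2.1 h
    · exact Finset.disjoint_left.2 fun w h h' => (Finset.mem_filter.1 h').2.1 h
    · exact Finset.disjoint_left.2 fun w h h' =>
        (Finset.mem_filter.1 h').2.2 (Finset.mem_filter.1 h).2.2
    · intro w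
      by_cases h1 : w ∈ K
      · exact Or.inl h1
      · by_cases h2 : ∃ a ∈ bookPage k x i, a ∈ B w
        · exact Or.inr (Or.inl (Finset.mem_filter.2 ⟨Finset.mem_univ _, h1, h2⟩))
        · exact Or.inr (Or.inr (Finset.mem_filter.2 ⟨Finset.mem_univ _, h1, h2⟩))
    · intro a ha b hb hab
      obtain ⟨-, haK, c, hc, hca⟩ := Finset.mem_filter.1 ha
      obtain ⟨-, hbK, hbn⟩ := Finset.mem_filter.1 hb
      obtain ⟨i₁, h₁⟩ := hout a haK
      obtain ⟨i₂, h₂⟩ := hout b hbK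
      obtain ⟨u, hu, v, hv, huv⟩ := hadj hab
      obtain ⟨p, rfl⟩ := h₁ u hu
      obtain ⟨q, rfl⟩ := h₂ v hv
      obtain ⟨r, rfl⟩ := h₁ c hca
      obtain rfl : i₁ = i₂ := huv.2 _ _ rfl rfl
      rw [inr_mem_bookPage] at hc
      exact hbn ⟨_, by simpa using hc, hv⟩
  have := card_le_card_of_disjoint_of_meet hdis (R := Finset.univ) (Q := bookPage k x i) (by
    intro w _
    by_cases hw : w ∈ K
    · obtain ⟨a, ha, haB⟩ := (Finset.mem_filter.1 hw).2
      rcases a with a | p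
      · exact ⟨_, by simp, haB⟩
      · simp at ha
    · exact hall w hw)
  rw [card_bookPage, Finset.card_univ] at this
  omega

end book

/-- Extending a suitable book of cliques by vertices attached to sets of `δ(H) - 1` vertices of its
pages, at most one for each such set, gives an `M(H)`-saturated graph. -/
theorem minorSaturated_attach_cliqueBook {W : Type*} [Fintype W] {H : SimpleGraph W}
    [DecidableRel H.Adj] [Nonempty W] {k m x : ℕ} {T : Finset (Finset (Fin k ⊕ Fin m × Fin x))}
    (hT : ∀ A ∈ T, A.card + 1 = H.minDegree) (hTp : ∀ A ∈ T, ∃ i, A ⊆ bookPage k x i)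
    (hTs : ∀ A ∈ T, ¬ A ⊆ bookSpine k m x) (hcard : Fintype.card W = k + x + 1)
    (hsep : ∀ K A B, H.Separates K A B → k < K.card)
    (hcrit : k + 1 = H.minDegree ∨ ∃ K A B, H.Separates K A B ∧ K.card = k + 1) :
    MinorSaturated H (attach (cliqueBook k m x) T) := by
  classical
  obtain ⟨w₀, hw₀⟩ := H.exists_minimal_degree_vertex
  refine ⟨fun h => not_isMinorOf_cliqueBook hsep (by omega) (h.of_attach (fun A hA => ?_)
    fun A hA => ?_), ?_⟩
  · obtain ⟨i, hi⟩ := hTp A hA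
    exact cliqueBook_isClique.subset (Finset.coe_subset.2 hi)
  · have := hT A hA
    omega
  let ι : (Fin k ⊕ Fin m × Fin x) ↪ (Fin k ⊕ Fin m × Fin x) ⊕ T := Function.Embedding.inl
  have hclique : ∀ (i : Fin m) u v a b, a ∈ bookPage k x i → b ∈ bookPage k x i → a ≠ b →
      ((attach (cliqueBook k m x) T).addEdge u v).Adj (Sum.inl a) (Sum.inl b) :=
    fun i u v a b ha hb hab => addEdge_adj.2 (Or.inl (cliqueBook_isClique ha hb hab))
  have hmap : ∀ (i : Fin m) u v, ((attach (cliqueBook k m x) T).addEdge u v).IsClique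
      ((bookPage k x i).map ι) := by
    intro i u v a ha b hb hab
    obtain ⟨a, ha', rfl⟩ := Finset.mem_map.1 (Finset.mem_coe.1 ha)
    obtain ⟨b, hb', rfl⟩ := Finset.mem_map.1 (Finset.mem_coe.1 hb)
    exact hclique i u v a b ha' hb' fun h => hab (h ▸ rfl)
  let Touches : (Fin k ⊕ Fin m × Fin x) ⊕ T → (Fin k ⊕ Fin m × Fin x) → Prop :=
    fun u c => u = Sum.inl c ∨ ∃ A : T, u = Sum.inr A ∧ c ∈ A.1
  have hpair : ∀ u v w c, Touches w c →
      ((attach (cliqueBook k m x) T).addEdge u v).SetConnected {Sum.inl c, w} := by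
    rintro u v w c (rfl | ⟨A, rfl, hA⟩)
    · exact setConnected_pair (Or.inl rfl)
    · exact setConnected_pair (Or.inr (addEdge_adj.2 (Or.inl hA)))
  have hmem : ∀ {w c a}, Touches w c →
      Sum.inl a ∈ ({Sum.inl c, w} : Set ((Fin k ⊕ Fin m × Fin x) ⊕ T)) → a = c := by
    rintro w c a hw (h | h)
    · exact Sum.inl_injective h
    · rcases hw with rfl | ⟨A, rfl, hA⟩
      · exact Sum.inl_injective h
      · simp at h
  have hedge : ∀ u v, u ≠ v → ((attach (cliqueBook k m x) T).addEdge u v).Adj u v :=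
    fun u v huv => addEdge_adj.2 (Or.inr ⟨rfl, huv⟩)
  have hsame : ∀ (i : Fin m) u (A : T) c, Touches u c → c ∈ bookPage k x i → c ∉ A.1 →
      A.1 ⊆ bookPage k x i → u ≠ Sum.inr A →
      H.IsMinorOf ((attach (cliqueBook k m x) T).addEdge u (Sum.inr A)) := by
    intro i u A c huc hci hcA hAi huA
    refine isMinorOf_of_clique (w₀ := w₀) (Q := (bookPage k x i).map ι) (D := A.1.map ι)
      (c := Sum.inl c) (X := {Sum.inl c, u}) (Y := {Sum.inr A}) (hmap i _ _) ?_ ?_ ?_ ?_ ?_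
      (hpair _ _ _ _ huc) (setConnected_singleton _ _) (by simp) ?_ ?_ ?_ ?_ ?_
    · simpa using hcard
    · exact Finset.mem_map_of_mem ι hci
    · exact Finset.map_subset_map.2 hAi
    · exact fun h => hcA ((Finset.mem_map' ι).1 h)
    · rw [← hw₀, Finset.card_map, hT A.1 A.2]
    · rintro a ha haQ
      obtain ⟨a, -, rfl⟩ := Finset.mem_map.1 haQ
      exact congrArg Sum.inl (hmem huc ha)
    · rintro _ rfl h
      obtain ⟨a, -, ha⟩ := Finset.mem_map.1 h
      cases ha
    · rw [Set.disjoint_singleton_right]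
      rintro (h | h)
      · cases h
      · exact huA h.symm
    · intro a ha
      obtain ⟨a, ha', rfl⟩ := Finset.mem_map.1 ha
      exact ⟨_, rfl, addEdge_adj.2 (Or.inl ha')⟩
    · exact ⟨_, rfl, u, by simp, (hedge _ _ huA).symm⟩
  have hdiff : ∀ (i j : Fin m) p q u v, i ≠ j → Touches u (Sum.inr (i, p)) →
      Touches v (Sum.inr (j, q)) → u ≠ v →
      H.IsMinorOf ((attach (cliqueBook k m x) T).addEdge u v) := by
    intro i j p q u v hij hu hv huv
    have hspine : ∀ (i : Fin m) a, a ∈ bookSpine k m x → a ∈ bookPage k x i := by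
      rintro i (a | a) ha
      · simp
      · simp at ha
    have hXY : Disjoint ({Sum.inl (Sum.inr (i, p)), u} : Set ((Fin k ⊕ Fin m × Fin x) ⊕ T))
        {Sum.inl (Sum.inr (j, q)), v} := by
      rw [Set.disjoint_left]
      rintro (a | A) ha hb
      · have := (hmem hu ha).symm.trans (hmem hv hb)
        simp only [Sum.inr.injEq, Prod.mk.injEq] at this
        exact hij this.1
      · simp only [Set.mem_insert_iff, reduceCtorEq, false_or, Set.mem_singleton_iff] at ha hb
        exact huv (ha.symm.trans hb)
    rcases hcrit with hk | ⟨K, A, B, hS, hKc⟩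
    · refine isMinorOf_of_clique (w₀ := w₀) (Q := (bookPage k x i).map ι)
        (D := (bookSpine k m x).map ι) (c := Sum.inl (Sum.inr (i, p)))
        (X := {Sum.inl (Sum.inr (i, p)), u}) (Y := {Sum.inl (Sum.inr (j, q)), v})
        (hmap i _ _) ?_ ?_ ?_ ?_ ?_ (hpair _ _ _ _ hu) (hpair _ _ _ _ hv) (by simp) ?_ ?_ hXY
        ?_ ?_
      · simpa using hcard
      · exact Finset.mem_map_of_mem ι (by simp)
      · exact Finset.map_subset_map.2 fun a => hspine i a
      · exact fun h => inr_notMem_bookSpine ((Finset.mem_map' ι).1 h)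
      · rw [← hw₀, Finset.card_map, card_bookSpine, hk]
      · rintro a ha haQ
        obtain ⟨a, -, rfl⟩ := Finset.mem_map.1 haQ
        exact congrArg Sum.inl (hmem hu ha)
      · rintro a ha haQ
        obtain ⟨a, haQ', rfl⟩ := Finset.mem_map.1 haQ
        rw [hmem hv ha, inr_mem_bookPage] at haQ'
        exact hij haQ'.symm
      · intro a ha
        obtain ⟨a, ha', rfl⟩ := Finset.mem_map.1 ha
        refine ⟨Sum.inl (Sum.inr (j, q)), by simp,
          hclique j _ _ _ _ (by simp) (hspine j a ha') ?_⟩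
        rintro rfl
        simp at ha'
      · exact ⟨v, by simp, u, by simp, (hedge _ _ huv).symm⟩
    · have hcards : K.card + A.card + B.card = k + x + 1 := by
        rw [← hcard, ← Finset.card_univ, ← Finset.card_union_of_disjoint hS.disjoint_left,
          ← Finset.card_union_of_disjoint
            (Finset.disjoint_union_left.2 ⟨hS.disjoint_right, hS.disjoint⟩)]
        congr 1
        ext w
        have := hS.cover w
        simpa [or_assoc] using this
      have hA := hS.left_nonempty.card_pos
      have hB := hS.right_nonempty.card_pos
      have hside : ∀ (i : Fin m) p, (((bookPage k x i \ bookSpine k m x).erase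
          (Sum.inr (i, p))).map ι).card = x - 1 := by
        intro i p
        rw [Finset.card_map, Finset.card_erase_of_mem (by simp),
          Finset.card_sdiff_of_subset (fun a => hspine i a)]
        simp
      have hadj : ∀ (i : Fin m) p a, a ∈ (bookSpine k m x).map ι ∨
          a ∈ ((bookPage k x i \ bookSpine k m x).erase (Sum.inr (i, p))).map ι →
          ∃ b ∈ bookPage k x i, a = Sum.inl b ∧ b ≠ Sum.inr (i, p) := by
        rintro i p a (h | h)
        · obtain ⟨b, hb, rfl⟩ := Finset.mem_map.1 h
          refine ⟨b, hspine i b hb, rfl, ?_⟩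
          rintro rfl
          simp at hb
        · obtain ⟨b, hb, rfl⟩ := Finset.mem_map.1 h
          rw [Finset.mem_erase, Finset.mem_sdiff] at hb
          exact ⟨b, hb.2.1, rfl, hb.1⟩
      have hpages : ∀ (i : Fin m) p u v a b, (a ∈ (bookSpine k m x).map ι ∨
          a ∈ ((bookPage k x i \ bookSpine k m x).erase (Sum.inr (i, p))).map ι) →
          (b ∈ (bookSpine k m x).map ι ∨
          b ∈ ((bookPage k x i \ bookSpine k m x).erase (Sum.inr (i, p))).map ι) → a ≠ b →
          ((attach (cliqueBook k m x) T).addEdge u v).Adj a b := by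
        intro i p u v a b ha hb hab
        obtain ⟨a, ha', rfl, -⟩ := hadj i p a ha
        obtain ⟨b, hb', rfl, -⟩ := hadj i p b hb
        exact hclique i _ _ _ _ ha' hb' fun h => hab (h ▸ rfl)
      have hsides : ∀ (i : Fin m) p, Disjoint ((bookSpine k m x).map ι)
          (((bookPage k x i \ bookSpine k m x).erase (Sum.inr (i, p))).map ι) := fun i p =>
        (Finset.disjoint_map ι).2
          (Finset.disjoint_of_subset_right (Finset.erase_subset _ _) Finset.disjoint_sdiff)
      refine isMinorOf_of_separates hS (Finset.card_pos.1 (by omega))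
        (S := (bookSpine k m x).map ι)
        (P := ((bookPage k x i \ bookSpine k m x).erase (Sum.inr (i, p))).map ι)
        (Q := ((bookPage k x j \ bookSpine k m x).erase (Sum.inr (j, q))).map ι)
        (L := {Sum.inl (Sum.inr (i, p)), u} ∪ {Sum.inl (Sum.inr (j, q)), v})
        ?_ ?_ ?_ (hsides i p) (hsides j q) ?_ (hpages i p u v) (hpages j q u v)
        ((hpair _ _ _ _ hu).union (hpair _ _ _ _ hv) (x := u) (y := v) (by simp) (by simp)
          (hedge _ _ huv)) ?_ ?_
      · simp [hKc]
      · rw [hside]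
        omega
      · rw [hside]
        omega
      · rw [Finset.disjoint_map, Finset.disjoint_left]
        rintro (a | a) ha hb
        · simp at ha
        · simp only [Finset.mem_erase, Finset.mem_sdiff, inr_mem_bookPage] at ha hb
          exact hij (ha.2.1.symm.trans hb.2.1)
      · have hL : ∀ a, Sum.inl a ∈ ({Sum.inl (Sum.inr (i, p)), u} ∪
            {Sum.inl (Sum.inr (j, q)), v} : Set ((Fin k ⊕ Fin m × Fin x) ⊕ T)) →
            a = Sum.inr (i, p) ∨ a = Sum.inr (j, q) := fun a h =>
          h.imp (fun h => hmem hu h) fun h => hmem hv h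
        rintro (a | A) ha
        · rw [show (Sum.inl a : (Fin k ⊕ Fin m × Fin x) ⊕ T) = ι a from rfl, Finset.mem_map',
            Finset.mem_map', Finset.mem_map']
          rcases hL a ha with rfl | rfl
          · simp [hij]
          · simp [hij.symm]
        · simp [ι]
      · rintro a (h | h | h)
        · obtain ⟨b, hb, rfl, hbp⟩ := hadj i p a (Or.inl h)
          exact ⟨_, by simp, hclique i _ _ _ _ (by simp) hb hbp.symm⟩
        · obtain ⟨b, hb, rfl, hbp⟩ := hadj i p a (Or.inr h)
          exact ⟨_, by simp, hclique i _ _ _ _ (by simp) hb hbp.symm⟩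
        · obtain ⟨b, hb, rfl, hbp⟩ := hadj j q a (Or.inr h)
          exact ⟨_, by simp, hclique j _ _ _ _ (by simp) hb hbp.symm⟩
  have hhome : ∀ A : T, ∃ i p, A.1 ⊆ bookPage k x i ∧ Sum.inr (i, p) ∈ A.1 := by
    intro A
    obtain ⟨i, hi⟩ := hTp A.1 A.2
    obtain ⟨a | ⟨j, p⟩, ha, has⟩ := Finset.not_subset.1 (hTs A.1 A.2)
    · simp at has
    · obtain rfl : j = i := by simpa using hi ha
      exact ⟨j, p, hi, ha⟩
  have hmain : ∀ u (A : T), u ≠ Sum.inr A → ¬ (attach (cliqueBook k m x) T).Adj u (Sum.inr A) →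
      H.IsMinorOf ((attach (cliqueBook k m x) T).addEdge u (Sum.inr A)) := by
    intro u A huA hadj
    obtain ⟨i, p, hAi, hA⟩ := hhome A
    rcases u with (a | ⟨j, q⟩) | A'
    · exact hsame i _ A _ (Or.inl rfl) (by simp) hadj hAi huA
    · by_cases hij : j = i
      · exact hsame i _ A _ (Or.inl rfl) (by simpa using hij) hadj hAi huA
      · exact hdiff j i q p _ _ hij (Or.inl rfl) (Or.inr ⟨A, rfl, hA⟩) huA
    · obtain ⟨j, q, hAj, hA'⟩ := hhome A'
      by_cases hij : j = i
      · subst hij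
        obtain ⟨c, hc, hcA⟩ : ∃ c ∈ A'.1, c ∉ A.1 := by
          by_contra! hsub
          have h1 := hT A.1 A.2
          have h2 := hT A'.1 A'.2
          have := Finset.eq_of_subset_of_card_le hsub (by omega)
          exact huA (congrArg Sum.inr (Subtype.ext this))
        exact hsame j _ A c (Or.inr ⟨A', rfl, hc⟩) (hAj hc) hcA hAi huA
      · exact hdiff j i q p _ _ hij (Or.inr ⟨A', rfl, hA'⟩) (Or.inr ⟨A, rfl, hA⟩) huA
  intro u v huv hadj
  rcases v with b | B
  · rcases u with a | A
    · have hab : a ≠ b := fun h => huv (h ▸ rfl)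
      rcases a with a | ⟨i, p⟩
      · exact absurd ⟨hab, by simp⟩ hadj
      · rcases b with b | ⟨j, q⟩
        · exact absurd ⟨hab, by simp⟩ hadj
        · by_cases hij : i = j
          · subst hij
            exact absurd (cliqueBook_isClique (i := i) (by simp) (by simp) hab) hadj
          · exact hdiff i j p q _ _ hij (Or.inl rfl) (Or.inl rfl) huv
    · rw [addEdge_comm]
      exact hmain _ A huv.symm fun h => hadj h.symm
  · exact hmain u B huv hadj

theorem exists_attaching_family {k m x e t : ℕ} (hke : k ≤ e)
    (ht : t ≤ m * ((k + x).choose e - 1)) :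
    ∃ T : Finset (Finset (Fin k ⊕ Fin m × Fin x)), T.card = t ∧
      ∀ A ∈ T, A.card = e ∧ (∃ i, A ⊆ bookPage k x i) ∧ ¬ A ⊆ bookSpine k m x := by
  classical
  let F : Fin m → Finset (Finset (Fin k ⊕ Fin m × Fin x)) := fun i =>
    (Finset.powersetCard e (bookPage k x i)).erase (bookSpine k m x)
  have hF : ∀ i, ∀ A ∈ F i, A.card = e ∧ A ⊆ bookPage k x i ∧ ¬ A ⊆ bookSpine k m x := by
    intro i A hA
    obtain ⟨hne, hA⟩ := Finset.mem_erase.1 hA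
    obtain ⟨hsub, hAe⟩ := Finset.mem_powersetCard.1 hA
    refine ⟨hAe, hsub, fun h => hne (Finset.eq_of_subset_of_card_le h ?_)⟩
    rw [card_bookSpine, hAe]
    exact hke
  have hdisj : Set.PairwiseDisjoint (Finset.univ : Finset (Fin m)) F := by
    intro i _ j _ hij
    refine Finset.disjoint_left.2 fun A hi hj => hij ?_
    obtain ⟨-, hAi, hAs⟩ := hF i A hi
    obtain ⟨-, hAj, -⟩ := hF j A hj
    obtain ⟨a | p, ha, has⟩ := Finset.not_subset.1 hAs
    · simp at has
    · have h1 := hAi ha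
      have h2 := hAj ha
      rw [inr_mem_bookPage] at h1 h2
      exact h1.symm.trans h2
  have hcard : t ≤ (Finset.univ.biUnion F).card := by
    rw [Finset.card_biUnion hdisj]
    refine ht.trans ?_
    have := Finset.card_nsmul_le_sum Finset.univ (fun i => (F i).card)
      ((k + x).choose e - 1) (fun i _ => by
        have := Finset.pred_card_le_card_erase (s := Finset.powersetCard e (bookPage k x i))
          (a := bookSpine k m x)
        rwa [Finset.card_powersetCard, card_bookPage] at this)
    simpa using this
  obtain ⟨T, hT, hTt⟩ := Finset.exists_subset_card_eq hcard
  refine ⟨T, hTt, fun A hA => ?_⟩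
  obtain ⟨i, -, hi⟩ := Finset.mem_biUnion.1 (hT hA)
  obtain ⟨h1, h2, h3⟩ := hF i A hi
  exact ⟨h1, ⟨i, h2⟩, h3⟩

theorem ncard_edgeSet_attach_cliqueBook_le {k m x e : ℕ}
    {T : Finset (Finset (Fin k ⊕ Fin m × Fin x))} (hT : ∀ A ∈ T, A.card = e) :
    (attach (cliqueBook k m x) T).edgeSet.ncard ≤
      (k + 1).choose 2 + (m * (x.choose 2 + k * x) + T.card * e) := by
  classical
  let g : Sym2 (Fin k) ⊕ (Fin m × ({z : Sym2 (Fin x) // ¬ z.IsDiag} ⊕ Fin k × Fin x)) ⊕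
      (Σ A : T, A.1) → Sym2 ((Fin k ⊕ Fin m × Fin x) ⊕ T)
    | .inl z => z.map fun a => .inl (.inl a)
    | .inr (.inl (i, .inl z)) => z.1.map fun p => .inl (.inr (i, p))
    | .inr (.inl (i, .inr (a, p))) => s(.inl (.inl a), .inl (.inr (i, p)))
    | .inr (.inr ⟨A, a⟩) => s(.inl a.1, .inr A)
  have hsub : (attach (cliqueBook k m x) T).edgeSet ⊆ Set.range g := by
    intro z
    induction z with
    | h u v =>
      intro huv
      rw [mem_edgeSet] at huv
      rcases u with (a | ⟨i, p⟩) | A <;> rcases v with (b | ⟨j, q⟩) | B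
      · exact ⟨.inl s(a, b), rfl⟩
      · exact ⟨.inr (.inl (j, .inr (a, q))), rfl⟩
      · exact ⟨.inr (.inr ⟨B, _, huv⟩), rfl⟩
      · exact ⟨.inr (.inl (i, .inr (b, p))), Sym2.eq_swap⟩
      · obtain rfl : i = j := huv.2 _ _ rfl rfl
        refine ⟨.inr (.inl (i, .inl ⟨s(p, q), ?_⟩)), rfl⟩
        rw [Sym2.mk_isDiag_iff]
        rintro rfl
        exact huv.1 rfl
      · exact ⟨.inr (.inr ⟨B, _, huv⟩), rfl⟩
      · exact ⟨.inr (.inr ⟨A, _, huv⟩), Sym2.eq_swap⟩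
      · exact ⟨.inr (.inr ⟨A, _, huv⟩), Sym2.eq_swap⟩
      · exact huv.elim
  calc _ ≤ (Set.range g).ncard := Set.ncard_le_ncard hsub (Set.toFinite _)
    _ ≤ Nat.card _ := by
      rw [← Set.image_univ, ← Set.ncard_univ]
      exact Set.ncard_image_le Set.finite_univ
    _ = _ := by
      have : ∑ A : T, A.1.card = T.card * e := by
        rw [Finset.sum_congr rfl fun A _ => hT A.1 A.2]
        simp
      have hx : Fintype.card {z : Sym2 (Fin x) // ¬ z.IsDiag} = x.choose 2 := by
        rw [Sym2.card_subtype_not_diag, Fintype.card_fin]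
      simp only [Nat.card_eq_fintype_card, Fintype.card_sum, Fintype.card_prod, Fintype.card_fin,
        Sym2.card, Fintype.card_sigma, Fintype.card_coe, hx, this]

end SimpleGraph

theorem edge_density_le {e k x m n t c₀ : ℕ} {D : ℚ} (hke : k ≤ e) (hx : e + 1 ≤ k + x)
    (hn : n = k + m * x + t) (hD : 0 < D) (hm : ((m : ℚ) - 1) * D ≤ n) :
    ((c₀ + (m * (x.choose 2 + k * x) + t * e) : ℕ) : ℚ) ≤
      (e + (((k + x).choose 2 : ℕ) + ((e + 1).choose 2 : ℕ) - (e : ℚ) * (k + x)) / D) * n +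
        (c₀ + (((k + x).choose 2 : ℕ) + ((e + 1).choose 2 : ℕ) - (e : ℚ) * (k + x))) := by
  set N : ℚ := ((k + x).choose 2 : ℕ) + ((e + 1).choose 2 : ℕ) - (e : ℚ) * (k + x) with hN
  have hxq : (e : ℚ) + 1 ≤ k + x := by exact_mod_cast hx
  have hkq : (k : ℚ) ≤ e := by exact_mod_cast hke
  have hN' : N = ((k : ℚ) + x - e) * (k + x - e - 1) / 2 := by
    rw [hN, Nat.cast_choose_two, Nat.cast_choose_two]
    push_cast
    ring
  have hN0 : 0 ≤ N := by
    rw [hN']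
    have : 0 ≤ ((k : ℚ) + x - e) * (k + x - e - 1) :=
      mul_nonneg (by linarith) (by linarith)
    linarith
  have hN1 : (x.choose 2 : ℚ) + k * x - e * x ≤ N := by
    have : (0 : ℚ) ≤ (e - k) * (e - k + 1) := mul_nonneg (by linarith) (by linarith)
    rw [hN', Nat.cast_choose_two]
    nlinarith
  have hmn : (m : ℚ) ≤ n / D + 1 := by
    have := (le_div_iff₀ hD).2 hm
    linarith
  have h1 : (m : ℚ) * (x.choose 2 + k * x - e * x) ≤ (n / D + 1) * N :=
    (mul_le_mul_of_nonneg_left hN1 (by positivity)).trans (mul_le_mul_of_nonneg_right hmn hN0)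
  have h2 : (e + N / D) * n + (c₀ + N) = (n / D + 1) * N + (e * n + c₀) := by ring
  have h3 : (0 : ℚ) ≤ e * k := by positivity
  rw [h2, hn] at *
  push_cast at *
  linarith

/-- General upper bound for the minor saturation number. -/
theorem sat_minor_general_upper_bound
    {W : Type*} [Fintype W] (H : SimpleGraph W) [DecidableRel H.Adj]
    (hconn : H.Connected) (s d : ℕ) (hs : Fintype.card W = s)
    (hd : H.minDegree = d) (hd3 : 3 ≤ d) :
    ∃ C : ℚ, ∃ N : ℕ, ∀ n ≥ N, ∃ G : SimpleGraph (Fin n),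
      MinorSaturated H G ∧
      (G.edgeSet.ncard : ℚ) ≤
        (((d : ℚ) - 1) +
            ((Nat.choose (s - 1) 2 : ℚ) + (Nat.choose d 2 : ℚ)
                - ((d : ℚ) - 1) * ((s : ℚ) - 1)) /
              ((Nat.choose (s - 1) (d - 1) : ℚ) + ((s : ℚ) - 1) - (d : ℚ))) * n
          + C := by
  classical
  have : Nonempty W := hconn.nonempty
  obtain ⟨w₀, hw₀⟩ := H.exists_minimal_degree_vertex
  have hds : d < s := by
    rw [← hd, ← hs, hw₀]
    exact H.degree_lt_card_verts w₀
  obtain ⟨e, rfl⟩ : ∃ e, d = e + 1 := ⟨d - 1, by omega⟩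
  obtain ⟨k, hke, hsep, hcrit⟩ := SimpleGraph.exists_critical_separator_size hconn e
  obtain ⟨x, rfl⟩ : ∃ x, s = k + x + 1 := ⟨s - 1 - k, by omega⟩
  simp only [Nat.add_sub_cancel]
  have hc : 2 ≤ (k + x).choose e := by
    obtain ⟨r, rfl⟩ : ∃ r, e = r + 1 := ⟨e - 1, by omega⟩
    obtain ⟨q, hq⟩ : ∃ q, k + x = q + 1 := ⟨k + x - 1, by omega⟩
    rw [hq, Nat.choose_succ_succ']
    have h1 := Nat.choose_pos (n := q) (k := r) (by omega)
    have h2 := Nat.choose_pos (n := q) (k := r + 1) (by omega)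
    omega
  set c := (k + x).choose e with hcdef
  set P := x + (c - 1) with hP
  have hDP : ((c : ℚ) + k + x - (e + 1)) ≤ P := by
    have : c + k + x ≤ P + (e + 1) := by omega
    have : ((c + k + x : ℕ) : ℚ) ≤ (P + (e + 1) : ℕ) := by exact_mod_cast this
    push_cast at this
    linarith
  have hD : (0 : ℚ) < (c : ℚ) + k + x - (e + 1) := by
    have : e + 1 < c + k + x := by omega
    have : ((e + 1 : ℕ) : ℚ) < (c + k + x : ℕ) := by exact_mod_cast this
    push_cast at this
    linarith
  refine ⟨((k + 1).choose 2 : ℕ) + (((k + x).choose 2 : ℕ) + ((e + 1).choose 2 : ℕ) -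
    (e : ℚ) * (k + x)), k + P * x, fun n hn => ?_⟩
  set q := (n - k) / P with hq
  have hqP : q * P ≤ n - k := Nat.div_mul_le_self _ _
  have hqP' : n - k < (q + 1) * P := by
    rw [mul_comm]
    exact Nat.lt_mul_div_succ _ (by omega)
  have hxq : x ≤ q := (Nat.le_div_iff_mul_le (by omega)).2 (by rw [mul_comm]; omega)
  have hqx : (q + 1) * x ≤ n - k := by
    have : q * (x + 1) ≤ q * P := Nat.mul_le_mul_left _ (by omega)
    linarith
  obtain ⟨T, hTt, hT⟩ := SimpleGraph.exists_attaching_family (k := k) (m := q + 1) (x := x)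
    (e := e) (t := n - k - (q + 1) * x) hke (by
      have : (q + 1) * P = (q + 1) * x + (q + 1) * (c - 1) := by rw [hP, mul_add]
      rw [← hcdef]
      omega)
  have hsat := SimpleGraph.minorSaturated_attach_cliqueBook (H := H) (T := T)
    (fun A hA => by rw [(hT A hA).1, hd]) (fun A hA => (hT A hA).2.1) (fun A hA => (hT A hA).2.2)
    hs hsep (by rw [hd]; exact hcrit.imp_left (congrArg (· + 1)))
  have hcard : Fintype.card ((Fin k ⊕ Fin (q + 1) × Fin x) ⊕ T) = n := by
    simp only [Fintype.card_sum, Fintype.card_prod, Fintype.card_fin, Fintype.card_coe, hTt]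
    omega
  let φ := Fintype.equivFinOfCardEq hcard
  let iso := SimpleGraph.Iso.map φ (SimpleGraph.attach (SimpleGraph.cliqueBook k (q + 1) x) T)
  refine ⟨_, hsat.of_iso iso, ?_⟩
  have hE := SimpleGraph.ncard_edgeSet_attach_cliqueBook_le (T := T) fun A hA => (hT A hA).1
  rw [hTt] at hE
  have hdens := edge_density_le (c₀ := (k + 1).choose 2) (m := q + 1) (n := n) (x := x)
    (t := n - k - (q + 1) * x) hke (by omega) (by omega) hD (by
      have h1 : (q : ℚ) * P ≤ n := by exact_mod_cast hqP.trans (Nat.sub_le _ _)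
      have h2 := mul_le_mul_of_nonneg_left hDP (Nat.cast_nonneg (α := ℚ) q)
      push_cast
      linarith)
  rw [← Nat.card_coe_set_eq, ← Nat.card_congr iso.mapEdgeSet, Nat.card_coe_set_eq]
  refine (Nat.cast_le.2 hE).trans (hdens.trans (le_of_eq ?_))
  push_cast
  ring
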